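/- arXiv:2502.14298 — 2 statements merged into one kernel-verified Lean document; each statement's English description precedes it below -/
import Mathlib

section
/- Let σ, σ_x, σ_p > 0, δ̂ ≥ 0, θ* ∈ ℝ^d, and let c = 2σ_p²(σ_x² + δ̂²)/σ². Let θ ∼ N(0, σ_p² I_d) and, independently, (x,y) ∼ P, where P is such that y = θ*ᵀx + ε with ε ∼ N(0,σ²) independent of x, x has mean zero and E[x xᵀ] = σ_x² I_d. Then for every t with 0 < t < 1/c, setting s² = (2/t)( c d − c t + 1 + σ_x² ‖θ*‖² / σ² ), the cumulant generating function of the adversarial loss with radius δ̂ satisfies log E[ exp( t ( R_δ̂(θ) − ℓ_δ̂(θ,(x,y)) ) ) ] ≤ s² t² / (2(1 − c t)), where R_δ̂(θ) = E_{(x,y)∼P}[ℓ_δ̂(θ,(x,y))]. That is, the adversarial loss is sub-gamma with variance s² and scale c. -/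
open MeasureTheory ProbabilityTheory Matrix

open scoped NNReal

/-- Tilting a centred Gaussian density by the exponential of a quadratic gives a multiple of another
Gaussian density. -/
lemma gaussianPDFReal_mul_exp_quadratic {v w : ℝ≥0} (hv : v ≠ 0) {a b : ℝ}
    (h : 2 * a * v < 1) (hw : (w : ℝ) = v / (1 - 2 * a * v)) (x : ℝ) :
    gaussianPDFReal 0 v x * Real.exp (a * x ^ 2 + b * x)
      = (√(1 / (1 - 2 * a * v)) * Real.exp (b ^ 2 * w / 2)) * gaussianPDFReal (b * w) w x := by
  have hv0 : (0 : ℝ) < v := by positivity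
  have hr : 0 < 1 - 2 * a * v := by linarith
  have hsqrt : √(2 * Real.pi * w) = √(2 * Real.pi * v) * √(1 / (1 - 2 * a * v)) := by
    rw [← Real.sqrt_mul (by positivity), hw]
    congr 1
    ring
  have hpos : 0 < √(1 / (1 - 2 * a * v)) := Real.sqrt_pos.2 (by positivity)
  have hpos' : 0 < √(2 * Real.pi * v) := Real.sqrt_pos.2 (by positivity)
  have hexp : Real.exp (-(x - 0) ^ 2 / (2 * v)) * Real.exp (a * x ^ 2 + b * x)
      = Real.exp (b ^ 2 * w / 2) * Real.exp (-(x - b * w) ^ 2 / (2 * w)) := by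
    have hw0 : (w : ℝ) ≠ 0 := hw ▸ (div_pos hv0 hr).ne'
    have hinv : 1 / (2 * (w : ℝ)) = 1 / (2 * v) - a := by
      rw [hw, ← mul_div_assoc, one_div_div]
      field_simp
    have hsq : -(x - b * w) ^ 2 / (2 * w) = -x ^ 2 * (1 / (2 * w)) + b * x - b ^ 2 * w / 2 := by
      field_simp
      ring
    rw [← Real.exp_add, ← Real.exp_add, hsq, hinv]
    congr 1
    ring
  simp only [gaussianPDFReal]
  rw [mul_assoc, hexp, hsqrt]
  generalize √(1 / (1 - 2 * a * v)) = y at hpos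
  field_simp

lemma exists_nnreal_tilted_variance (v : ℝ≥0) {a : ℝ} (h : 2 * a * v < 1) :
    ∃ w : ℝ≥0, (w : ℝ) = v / (1 - 2 * a * v) :=
  ⟨⟨v / (1 - 2 * a * v), div_nonneg v.2 (by linarith)⟩, rfl⟩

lemma integrable_exp_quadratic_gaussianReal {v : ℝ≥0} (hv : v ≠ 0) {a : ℝ} (b : ℝ)
    (h : 2 * a * v < 1) :
    Integrable (fun x => Real.exp (a * x ^ 2 + b * x)) (gaussianReal 0 v) := by
  obtain ⟨w, hw⟩ := exists_nnreal_tilted_variance v h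
  rw [gaussianReal_of_var_ne_zero _ hv, integrable_withDensity_iff_integrable_smul'
    (measurable_gaussianPDF _ _) (ae_of_all _ fun _ => gaussianPDF_lt_top)]
  simp only [toReal_gaussianPDF, smul_eq_mul, gaussianPDFReal_mul_exp_quadratic hv h hw]
  exact (integrable_gaussianPDFReal _ _).const_mul _

lemma integral_exp_quadratic_gaussianReal {v : ℝ≥0} (hv : v ≠ 0) {a : ℝ} (b : ℝ)
    (h : 2 * a * v < 1) :
    ∫ x, Real.exp (a * x ^ 2 + b * x) ∂gaussianReal 0 v
      = √(1 / (1 - 2 * a * v)) * Real.exp (b ^ 2 * v / (2 * (1 - 2 * a * v))) := by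
  obtain ⟨w, hw⟩ := exists_nnreal_tilted_variance v h
  have hw0 : w ≠ 0 := by
    rw [← NNReal.coe_ne_zero, hw]
    exact div_ne_zero (NNReal.coe_ne_zero.2 hv) (by linarith)
  rw [integral_gaussianReal_eq_integral_smul hv]
  simp only [smul_eq_mul, gaussianPDFReal_mul_exp_quadratic hv h hw]
  rw [integral_const_mul, integral_gaussianPDFReal_eq_one _ hw0, mul_one, hw]
  congr 2
  have : 1 - 2 * a * v ≠ 0 := by linarith
  field_simp

lemma sqrt_one_div_one_sub_le_exp {r : ℝ} (h0 : 0 ≤ r) (h1 : r < 1) :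
    √(1 / (1 - r)) ≤ Real.exp (r / (1 - r)) := by
  have hr : 0 < 1 - r := by linarith
  have h : 1 / (1 - r) = r / (1 - r) + 1 := by
    field_simp
    ring
  have hone : 1 ≤ 1 / (1 - r) := by
    rw [h]
    linarith [div_nonneg h0 hr.le]
  calc √(1 / (1 - r)) ≤ 1 / (1 - r) := by
        rw [Real.sqrt_le_left (by positivity)]
        nlinarith
    _ ≤ Real.exp (r / (1 - r)) := h ▸ Real.add_one_le_exp _

lemma integral_sq_gaussianReal_zero (v : ℝ≥0) : ∫ x, x ^ 2 ∂gaussianReal 0 v = v := by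
  have h := variance_fun_id_gaussianReal (μ := 0) (v := v)
  rwa [variance_of_integral_eq_zero aemeasurable_id' (integral_id_gaussianReal (μ := 0))] at h

section LinearModel

variable {d : ℕ} {μ : Measure (Fin d → ℝ)} {s : ℝ}

lemma integrable_mul_of_isotropic (hs : s ≠ 0)
    (hcov : ∀ i j, ∫ x, x i * x j ∂μ = if i = j then s else 0) (i j : Fin d) :
    Integrable (fun x => x i * x j) μ := by
  have hL (k : Fin d) : MemLp (fun x : Fin d → ℝ => x k) 2 μ := by
    rw [memLp_two_iff_integrable_sq (measurable_pi_apply k).aestronglyMeasurable]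
    refine Integrable.of_integral_ne_zero ?_
    simpa [pow_two, hcov] using hs
  exact (hL i).integrable_mul (hL j)

lemma sq_dotProduct_eq_sum (u x : Fin d → ℝ) :
    (u ⬝ᵥ x) ^ 2 = ∑ i, ∑ j, u i * u j * (x i * x j) := by
  simp only [pow_two, dotProduct, Finset.sum_mul_sum]
  exact Finset.sum_congr rfl fun i _ => Finset.sum_congr rfl fun j _ => by ring

lemma integrable_sq_dotProduct_of_isotropic (hs : s ≠ 0)
    (hcov : ∀ i j, ∫ x, x i * x j ∂μ = if i = j then s else 0) (u : Fin d → ℝ) :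
    Integrable (fun x => (u ⬝ᵥ x) ^ 2) μ := by
  simp only [sq_dotProduct_eq_sum]
  exact integrable_finsetSum _ fun i _ => integrable_finsetSum _ fun j _ =>
    (integrable_mul_of_isotropic hs hcov i j).const_mul _

lemma integral_sq_dotProduct_of_isotropic (hs : s ≠ 0)
    (hcov : ∀ i j, ∫ x, x i * x j ∂μ = if i = j then s else 0) (u : Fin d → ℝ) :
    ∫ x, (u ⬝ᵥ x) ^ 2 ∂μ = s * ∑ i, u i ^ 2 := by
  have hint (i j : Fin d) : Integrable (fun x => u i * u j * (x i * x j)) μ :=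
    (integrable_mul_of_isotropic hs hcov i j).const_mul _
  simp only [sq_dotProduct_eq_sum]
  rw [integral_finsetSum _ fun i _ => integrable_finsetSum _ fun j _ => hint i j, Finset.mul_sum]
  refine Finset.sum_congr rfl fun i _ => ?_
  rw [integral_finsetSum _ fun j _ => hint i j]
  simp only [integral_const_mul, hcov]
  simp
  ring

lemma memLp_two_add_dotProduct [IsProbabilityMeasure μ] (hs : s ≠ 0)
    (hcov : ∀ i j, ∫ x, x i * x j ∂μ = if i = j then s else 0) (v : ℝ≥0) (u : Fin d → ℝ) :
    MemLp (fun p : (Fin d → ℝ) × ℝ => p.2 + u ⬝ᵥ p.1) 2 (μ.prod (gaussianReal 0 v)) := by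
  have hm : Measurable fun x : Fin d → ℝ => u ⬝ᵥ x :=
    (show Continuous fun x : Fin d → ℝ => u ⬝ᵥ x by fun_prop).measurable
  have hx : MemLp (fun x => u ⬝ᵥ x) 2 μ :=
    (memLp_two_iff_integrable_sq hm.aestronglyMeasurable).2
      (integrable_sq_dotProduct_of_isotropic hs hcov u)
  have he : MemLp (fun e : ℝ => e) 2 (gaussianReal 0 v) := memLp_id_gaussianReal 2
  exact (he.comp_snd μ).add (hx.comp_fst (gaussianReal 0 v))

lemma integral_sq_add_dotProduct [IsProbabilityMeasure μ] (hs : s ≠ 0)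
    (hcov : ∀ i j, ∫ x, x i * x j ∂μ = if i = j then s else 0) (v : ℝ≥0) (u : Fin d → ℝ) :
    ∫ p, (p.2 + u ⬝ᵥ p.1) ^ 2 ∂(μ.prod (gaussianReal 0 v)) = v + s * ∑ i, u i ^ 2 := by
  have hm : Measurable fun x : Fin d → ℝ => u ⬝ᵥ x :=
    (show Continuous fun x : Fin d → ℝ => u ⬝ᵥ x by fun_prop).measurable
  have hx2 := integrable_sq_dotProduct_of_isotropic hs hcov u
  have hx1 : Integrable (fun x => u ⬝ᵥ x) μ :=
    ((memLp_two_iff_integrable_sq hm.aestronglyMeasurable).2 hx2).integrable one_le_two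
  have he : MemLp (fun e : ℝ => e) 2 (gaussianReal 0 v) := memLp_id_gaussianReal 2
  have i1 := he.integrable_sq.comp_snd μ
  have i2 := (hx1.mul_prod (he.integrable one_le_two)).const_mul 2
  have i3 := hx2.comp_fst (gaussianReal 0 v)
  have i12 : Integrable (fun p : (Fin d → ℝ) × ℝ => p.2 ^ 2 + 2 * ((u ⬝ᵥ p.1) * p.2))
      (μ.prod (gaussianReal 0 v)) := i1.add i2
  calc ∫ p, (p.2 + u ⬝ᵥ p.1) ^ 2 ∂(μ.prod (gaussianReal 0 v))
      = ∫ p, (p.2 ^ 2 + 2 * ((u ⬝ᵥ p.1) * p.2)) + (u ⬝ᵥ p.1) ^ 2 ∂(μ.prod (gaussianReal 0 v)) := by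
        congr with p
        ring
    _ = v + s * ∑ i, u i ^ 2 := by
        rw [integral_add i12 i3, integral_add i1 i2, integral_const_mul,
          integral_prod_mul (fun x => u ⬝ᵥ x) (fun e : ℝ => e), integral_id_gaussianReal,
          integral_fun_snd (fun e : ℝ => e ^ 2), integral_fun_fst (fun x => (u ⬝ᵥ x) ^ 2),
          integral_sq_gaussianReal_zero, integral_sq_dotProduct_of_isotropic hs hcov]
        simp

/-- The expected squared adversarial residual is at most twice the expected squared residual plus
twice the squared perturbation. -/
lemma integral_sq_abs_add_le {Ω : Type*} [MeasurableSpace Ω] {ν : Measure Ω}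
    [IsProbabilityMeasure ν] {f : Ω → ℝ} (hf : MemLp f 2 ν) (b : ℝ) :
    ∫ ω, (|f ω| + b) ^ 2 ∂ν ≤ 2 * ∫ ω, f ω ^ 2 ∂ν + 2 * b ^ 2 := by
  calc ∫ ω, (|f ω| + b) ^ 2 ∂ν ≤ ∫ ω, 2 * f ω ^ 2 + 2 * b ^ 2 ∂ν := by
        refine integral_mono_of_nonneg (ae_of_all _ fun ω => sq_nonneg _)
          ((hf.integrable_sq.const_mul 2).add (integrable_const _)) (ae_of_all _ fun ω => ?_)
        change (|f ω| + b) ^ 2 ≤ 2 * f ω ^ 2 + 2 * b ^ 2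
        nlinarith [sq_nonneg (|f ω| - b), sq_abs (f ω)]
    _ = 2 * ∫ ω, f ω ^ 2 ∂ν + 2 * b ^ 2 := by
        rw [integral_add (hf.integrable_sq.const_mul 2) (integrable_const _), integral_const_mul]
        simp

end LinearModel

/-- Sub-gamma CGF bound for the adversarial Gaussian NLL loss with radius `δ̂`: with
prior `θ ∼ N(0, σ_p² I_d)`, data `(x,y) ∼ P` where `y = θ*ᵀx + ε`, `ε ∼ N(0,σ²)`
independent of `x`, `E[x] = 0` and `E[xxᵀ] = σ_x² I_d`, and
`c = 2σ_p²(σ_x² + δ̂²)/σ²`, for every `0 < t < 1/c`, with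
`s² = (2/t)(cd − ct + 1 + σ_x²‖θ*‖²/σ²)`,
`log E[exp(t(R_δ̂(θ) − ℓ_δ̂(θ,(x,y))))] ≤ s²t²/(2(1 − ct))`. -/
theorem cgf_bound_adversarial_loss
    (d : ℕ) (σ σx σp δh : ℝ) (hσ : 0 < σ) (hσx : 0 < σx) (hσp : 0 < σp) (hδh : 0 ≤ δh)
    (θstar : Fin d → ℝ) (c : ℝ) (hc : c = 2 * σp ^ 2 * (σx ^ 2 + δh ^ 2) / σ ^ 2)
    (Px : Measure (Fin d → ℝ)) [IsProbabilityMeasure Px]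
    (hmean : ∀ i, ∫ x, x i ∂Px = 0)
    (hcov : ∀ i j, ∫ x, x i * x j ∂Px = if i = j then σx ^ 2 else 0)
    (P : Measure ((Fin d → ℝ) × ℝ))
    (hP : P = (Px.prod (gaussianReal 0 ⟨σ ^ 2, sq_nonneg σ⟩)).map
      fun p => (p.1, θstar ⬝ᵥ p.1 + p.2))
    (prior : Measure (Fin d → ℝ))
    (hprior : prior = Measure.pi fun _ : Fin d => gaussianReal 0 ⟨σp ^ 2, sq_nonneg σp⟩)
    (ℓa : (Fin d → ℝ) → ((Fin d → ℝ) × ℝ) → ℝ)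
    (hℓa : ℓa = fun θ p => (1 / 2) * Real.log (2 * Real.pi * σ ^ 2)
      + (1 / (2 * σ ^ 2))
        * (|p.2 - θ ⬝ᵥ p.1| + δh * Real.sqrt (∑ j, θ j ^ 2)) ^ 2)
    (Ra : (Fin d → ℝ) → ℝ) (hRa : Ra = fun θ => ∫ p, ℓa θ p ∂P)
    (t : ℝ) (ht : 0 < t) (htc : t < 1 / c)
    (s2 : ℝ)
    (hs2 : s2 = (2 / t) * (c * (d : ℝ) - c * t + 1
      + σx ^ 2 * (∑ i, θstar i ^ 2) / σ ^ 2)) :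
    Real.log (∫ q, Real.exp (t * (Ra q.1 - ℓa q.1 q.2)) ∂(prior.prod P))
      ≤ s2 * t ^ 2 / (2 * (1 - c * t)) := by
  obtain ⟨v, hv, hvσ⟩ : ∃ v : ℝ≥0, gaussianReal 0 ⟨σ ^ 2, sq_nonneg σ⟩ = gaussianReal 0 v ∧
      (v : ℝ) = σ ^ 2 := ⟨.mk (σ ^ 2) (sq_nonneg σ), rfl, rfl⟩
  obtain ⟨w, hw, hwσ⟩ : ∃ w : ℝ≥0, gaussianReal 0 ⟨σp ^ 2, sq_nonneg σp⟩ = gaussianReal 0 w ∧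
      (w : ℝ) = σp ^ 2 := ⟨.mk (σp ^ 2) (sq_nonneg σp), rfl, rfl⟩
  rw [hv] at hP
  simp only [hw] at hprior
  have hcpos : 0 < c := by rw [hc]; positivity
  have hct : c * t < 1 := by rwa [lt_div_iff₀ hcpos, mul_comm] at htc
  have hct0 : 0 < c * t := by positivity
  have hden : 0 < 1 - c * t := by linarith
  have hmeas : Measurable fun p : (Fin d → ℝ) × ℝ => (p.1, θstar ⬝ᵥ p.1 + p.2) :=
    (show Continuous fun p : (Fin d → ℝ) × ℝ => (p.1, θstar ⬝ᵥ p.1 + p.2) by fun_prop).measurable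
  have hPprob : IsProbabilityMeasure P := by
    rw [hP]
    exact Measure.isProbabilityMeasure_map hmeas.aemeasurable
  have hpriorprob : IsProbabilityMeasure prior := by
    rw [hprior]
    infer_instance
  have hrisk (θ : Fin d → ℝ) : Ra θ ≤ (1 / 2) * Real.log (2 * Real.pi * σ ^ 2)
      + (1 / (2 * σ ^ 2)) * (2 * (σ ^ 2 + σx ^ 2 * ∑ i, (θstar i - θ i) ^ 2)
        + 2 * (δh * √(∑ j, θ j ^ 2)) ^ 2) := by
    have hf := memLp_two_add_dotProduct (pow_ne_zero 2 hσx.ne') hcov v (θstar - θ)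
    have hbound := integral_sq_abs_add_le hf (δh * √(∑ j, θ j ^ 2))
    rw [integral_sq_add_dotProduct (pow_ne_zero 2 hσx.ne') hcov, hvσ] at hbound
    have hint : Integrable (fun p : (Fin d → ℝ) × ℝ =>
        (|p.2 + (θstar - θ) ⬝ᵥ p.1| + δh * √(∑ j, θ j ^ 2)) ^ 2) (Px.prod (gaussianReal 0 v)) :=
      (hf.abs.add (memLp_const (δh * √(∑ j, θ j ^ 2)))).integrable_sq
    have hcont : Continuous (ℓa θ) := by
      rw [hℓa]
      fun_prop
    have heq : Ra θ = ∫ p, ((1 / 2) * Real.log (2 * Real.pi * σ ^ 2) + (1 / (2 * σ ^ 2))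
        * (|p.2 + (θstar - θ) ⬝ᵥ p.1| + δh * √(∑ j, θ j ^ 2)) ^ 2) ∂(Px.prod (gaussianReal 0 v)) := by
      rw [hRa, hP]
      change ∫ p, ℓa θ p ∂_ = _
      rw [integral_map hmeas.aemeasurable hcont.aestronglyMeasurable, hℓa]
      congr with p
      simp only [sub_dotProduct]
      ring_nf
    rw [heq, integral_add (integrable_const _) (hint.const_mul _), integral_const, probReal_univ,
      one_smul, integral_const_mul]
    gcongr
    exact hbound
  have hexponent (q : (Fin d → ℝ) × ((Fin d → ℝ) × ℝ)) :
      t * (Ra q.1 - ℓa q.1 q.2) ≤ t * (1 + σx ^ 2 * (∑ i, θstar i ^ 2) / σ ^ 2)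
        + ∑ i, (t * (σx ^ 2 + δh ^ 2) / σ ^ 2 * q.1 i ^ 2
          + -(2 * t * σx ^ 2 * θstar i / σ ^ 2) * q.1 i) := by
    have hloss : (1 / 2) * Real.log (2 * Real.pi * σ ^ 2) ≤ ℓa q.1 q.2 := by
      rw [hℓa]
      exact le_add_of_nonneg_right (by positivity)
    have hsq : √(∑ j, q.1 j ^ 2) ^ 2 = ∑ j, q.1 j ^ 2 := Real.sq_sqrt (by positivity)
    have hexpand : ∑ i, (θstar i - q.1 i) ^ 2
        = ∑ i, θstar i ^ 2 - 2 * ∑ i, θstar i * q.1 i + ∑ i, q.1 i ^ 2 := by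
      rw [Finset.mul_sum, ← Finset.sum_sub_distrib, ← Finset.sum_add_distrib]
      exact Finset.sum_congr rfl fun i _ => by ring
    have hlin : ∑ i, -(2 * t * σx ^ 2 * θstar i / σ ^ 2) * q.1 i
        = -(2 * t * σx ^ 2 / σ ^ 2) * ∑ i, θstar i * q.1 i := by
      rw [Finset.mul_sum]
      exact Finset.sum_congr rfl fun i _ => by ring
    have hr := hrisk q.1
    rw [mul_pow, hsq, hexpand] at hr
    rw [Finset.sum_add_distrib, ← Finset.mul_sum, hlin]
    refine (mul_le_mul_of_nonneg_left (sub_le_sub hr hloss) ht.le).trans (le_of_eq ?_)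
    field_simp
    ring
  have hw0 : w ≠ 0 := by
    rw [← NNReal.coe_ne_zero, hwσ]
    exact pow_ne_zero 2 hσp.ne'
  have haw : 2 * (t * (σx ^ 2 + δh ^ 2) / σ ^ 2) * w = c * t := by
    rw [hc, hwσ]
    ring
  have hcoord (i : Fin d) : ∫ x, Real.exp (t * (σx ^ 2 + δh ^ 2) / σ ^ 2 * x ^ 2
        + -(2 * t * σx ^ 2 * θstar i / σ ^ 2) * x) ∂gaussianReal 0 w
      ≤ Real.exp (c * t / (1 - c * t)
        + c * t / (1 - c * t) * (t * σx ^ 2 / σ ^ 2) * θstar i ^ 2) := by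
    rw [integral_exp_quadratic_gaussianReal hw0 _ (haw.trans_lt hct), haw, Real.exp_add]
    gcongr
    · exact sqrt_one_div_one_sub_le_exp hct0.le hct
    · rw [hwσ]
      calc (-(2 * t * σx ^ 2 * θstar i / σ ^ 2)) ^ 2 * σp ^ 2 / (2 * (1 - c * t))
          = 2 * σp ^ 2 * σx ^ 2 / σ ^ 2 * t / (1 - c * t) * (t * σx ^ 2 / σ ^ 2)
            * θstar i ^ 2 := by
            field_simp
        _ ≤ _ := by
            gcongr
            rw [hc]
            gcongr
            nlinarith [sq_nonneg δh]
  have hprodint : Integrable (fun θ : Fin d → ℝ => ∏ i, Real.exp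
      (t * (σx ^ 2 + δh ^ 2) / σ ^ 2 * θ i ^ 2 + -(2 * t * σx ^ 2 * θstar i / σ ^ 2) * θ i))
      prior := by
    rw [hprior]
    exact Integrable.fintype_prod (f := fun i x => Real.exp
      (t * (σx ^ 2 + δh ^ 2) / σ ^ 2 * x ^ 2 + -(2 * t * σx ^ 2 * θstar i / σ ^ 2) * x))
      fun i => integrable_exp_quadratic_gaussianReal hw0 _ (haw.trans_lt hct)
  have hrhs : s2 * t ^ 2 / (2 * (1 - c * t))
      = t * (1 + σx ^ 2 * (∑ i, θstar i ^ 2) / σ ^ 2) + ∑ i, (c * t / (1 - c * t)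
        + c * t / (1 - c * t) * (t * σx ^ 2 / σ ^ 2) * θstar i ^ 2) := by
    rw [Finset.sum_add_distrib, ← Finset.mul_sum, Finset.sum_const, Finset.card_univ,
      Fintype.card_fin, nsmul_eq_mul, hs2]
    obtain ⟨D, hD⟩ : ∃ D, D = 1 - c * t := ⟨_, rfl⟩
    rw [← hD] at hden ⊢
    field_simp
    rw [hD]
    ring
  have hbound : ∫ q, Real.exp (t * (Ra q.1 - ℓa q.1 q.2)) ∂(prior.prod P)
      ≤ Real.exp (s2 * t ^ 2 / (2 * (1 - c * t))) := by
    calc ∫ q, Real.exp (t * (Ra q.1 - ℓa q.1 q.2)) ∂(prior.prod P)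
        ≤ ∫ q, Real.exp (t * (1 + σx ^ 2 * (∑ i, θstar i ^ 2) / σ ^ 2))
          * ∏ i, Real.exp (t * (σx ^ 2 + δh ^ 2) / σ ^ 2 * q.1 i ^ 2
            + -(2 * t * σx ^ 2 * θstar i / σ ^ 2) * q.1 i) ∂(prior.prod P) := by
          refine integral_mono_of_nonneg (ae_of_all _ fun q => (Real.exp_pos _).le)
            ((hprodint.comp_fst P).const_mul _) (ae_of_all _ fun q => ?_)
          simp only [← Real.exp_sum, ← Real.exp_add]
          exact Real.exp_le_exp.2 (hexponent q)
      _ = Real.exp (t * (1 + σx ^ 2 * (∑ i, θstar i ^ 2) / σ ^ 2))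
          * ∏ i, ∫ x, Real.exp (t * (σx ^ 2 + δh ^ 2) / σ ^ 2 * x ^ 2
            + -(2 * t * σx ^ 2 * θstar i / σ ^ 2) * x)
              ∂gaussianReal 0 w := by
          rw [integral_const_mul, integral_fun_fst (fun θ : Fin d → ℝ => ∏ i, Real.exp
            (t * (σx ^ 2 + δh ^ 2) / σ ^ 2 * θ i ^ 2
              + -(2 * t * σx ^ 2 * θstar i / σ ^ 2) * θ i)), probReal_univ, one_smul, hprior,
            integral_fintype_prod_eq_prod (fun i x => Real.exp
              (t * (σx ^ 2 + δh ^ 2) / σ ^ 2 * x ^ 2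
                + -(2 * t * σx ^ 2 * θstar i / σ ^ 2) * x))]
      _ ≤ Real.exp (s2 * t ^ 2 / (2 * (1 - c * t))) := by
          rw [hrhs, Real.exp_add, Real.exp_sum]
          gcongr with i
          exact hcoord i
  rcases (integral_nonneg fun q => (Real.exp_pos (t * (Ra q.1 - ℓa q.1 q.2))).le :
    0 ≤ ∫ q, Real.exp (t * (Ra q.1 - ℓa q.1 q.2)) ∂(prior.prod P)).eq_or_lt with h0 | h0
  · rw [← h0, Real.log_zero, hrhs]
    have hratio : 0 ≤ c * t / (1 - c * t) := div_nonneg hct0.le hden.le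
    generalize c * t / (1 - c * t) = r at hratio
    positivity
  · exact (Real.log_le_iff_le_exp h0).2 hbound
end

section
/- Let σ, σ_p > 0, δ̂ ≥ 0 with 2nδ̂²σ_p² < σ², let X ∈ ℝ^{n×d} have rows x_iᵀ, Y ∈ ℝ^n entries y_i, and let π = N(0, σ_p² I_d). Define L(θ) = (1/(2σ²))‖Y − Xθ‖², L_δ̂(θ) = Σ_{i=1}^n (1/(2σ²))(|y_i − x_iᵀθ| + δ̂‖θ‖₂)², z = ∫ exp(−L(θ)) dπ(θ), and let q be the probability measure with density exp(−L)/z with respect to π. Then E_{θ∼q}[(1/n) L_δ̂(θ)] + (1/n) KL(q‖π) ≤ (2/n) log(1/z) + d δ̂² σ_p² / (σ² − 2n δ̂² σ_p²). -/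
open MeasureTheory ProbabilityTheory Matrix

/-- The Kullback–Leibler divergence `∫ log (dq/dπ) dq` of `q` from `π`
(meaningful when `q ≪ π` and the integrand is integrable). -/
noncomputable def KLreal {Θ : Type*} [MeasurableSpace Θ] (ρ π : Measure Θ) : ℝ :=
  ∫ θ, Real.log ((ρ.rnDeriv π θ).toReal) ∂ρ

open Real in
/-- The square of a centred Gaussian of variance `v` has exponential moments of order
`t < 1 / (2 v)`. -/
lemma integrable_exp_mul_sq_gaussianReal {v : NNReal} {t : ℝ} (hv : v ≠ 0) (ht : 2 * t * v < 1) :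
    Integrable (fun x => exp (t * x ^ 2)) (gaussianReal 0 v) ∧
      ∫ x, exp (t * x ^ 2) ∂(gaussianReal 0 v) = (√(1 - 2 * t * v))⁻¹ := by
  have hv0 : (0 : ℝ) < v := by positivity
  have hpdf : (fun x => gaussianPDFReal 0 v x • exp (t * x ^ 2)) =
      fun x => (√(2 * π * v))⁻¹ * exp (-((1 - 2 * t * v) / (2 * v)) * x ^ 2) := by
    ext x
    rw [gaussianPDFReal_def, smul_eq_mul, mul_assoc, ← exp_add]
    congr 2
    field_simp
    ring
  have hb : 0 < (1 - 2 * t * v) / (2 * v) := div_pos (by linarith) (by positivity)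
  constructor
  · rw [gaussianReal_of_var_ne_zero _ hv, integrable_withDensity_iff_integrable_smul'
      (measurable_gaussianPDF _ _) (ae_of_all _ fun _ => gaussianPDF_lt_top)]
    simp only [toReal_gaussianPDF]
    rw [hpdf]
    exact (integrable_exp_neg_mul_sq hb).const_mul _
  · rw [integral_gaussianReal_eq_integral_smul hv, hpdf, integral_const_mul, integral_gaussian,
      ← sqrt_inv, ← sqrt_inv, ← sqrt_mul (by positivity)]
    have : 1 - 2 * t * v ≠ 0 := by linarith
    congr 1
    field_simp

open Real in
/-- Exponential moments of the squared Euclidean norm of an isotropic Gaussian vector. -/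
lemma integrable_exp_mul_sum_sq_pi_gaussianReal {ι : Type*} [Fintype ι] {v : NNReal} {t : ℝ}
    (hv : v ≠ 0) (ht : 2 * t * v < 1) :
    Integrable (fun θ : ι → ℝ => exp (t * ∑ j, θ j ^ 2))
        (Measure.pi fun _ : ι => gaussianReal 0 v) ∧
      ∫ θ, exp (t * ∑ j, θ j ^ 2) ∂(Measure.pi fun _ : ι => gaussianReal 0 v) =
        (√(1 - 2 * t * v))⁻¹ ^ Fintype.card ι := by
  obtain ⟨hint, heq⟩ := integrable_exp_mul_sq_gaussianReal hv ht
  simp only [Finset.mul_sum, exp_sum]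
  refine ⟨Integrable.fintype_prod (f := fun (_ : ι) (x : ℝ) => exp (t * x ^ 2))
    fun _ => hint, ?_⟩
  rw [integral_fintype_prod_eq_prod (f := fun (_ : ι) (x : ℝ) => exp (t * x ^ 2))]
  simp [heq]

open Real in
/-- Bound on `-log √(1 - u)` by a rational function. -/
lemma log_inv_sqrt_one_sub_le {u : ℝ} (hu : u < 1) :
    log (√(1 - u))⁻¹ ≤ u / (2 * (1 - u)) := by
  have h : 0 < 1 - u := by linarith
  have hlog := log_le_sub_one_of_pos (inv_pos.2 h)
  rw [log_inv] at hlog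
  rw [log_inv, log_sqrt h.le]
  have : u / (2 * (1 - u)) = ((1 - u)⁻¹ - 1) / 2 := by field_simp; ring
  linarith

open Real in
/-- Gibbs objective of the Gibbs measure with potential `L`, evaluated at a loss `A` that
exceeds `2 L` by at most a function `g` with an exponential moment. -/
lemma integral_add_KLreal_tilted_le {Θ : Type*} [MeasurableSpace Θ] (μ : Measure Θ)
    [IsProbabilityMeasure μ] {L A g : Θ → ℝ} (hL : Measurable L) (hA : Measurable A)
    (hg : Measurable g) (hL0 : ∀ θ, 0 ≤ L θ) (hA0 : ∀ θ, 0 ≤ A θ) (hg0 : ∀ θ, 0 ≤ g θ)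
    (hAL : ∀ θ, A θ ≤ 2 * L θ + g θ) (hexp : Integrable (fun θ => exp (g θ)) μ) :
    ∫ θ, A θ ∂(μ.tilted fun θ => -L θ) + KLreal (μ.tilted fun θ => -L θ) μ ≤
      2 * log (1 / ∫ θ, exp (-L θ) ∂μ) + log (∫ θ, exp (g θ) ∂μ) := by
  have hexpL : Integrable (fun θ => exp (-L θ)) μ :=
    Integrable.of_bound (by fun_prop) 1 (ae_of_all _ fun θ => by
      simpa [abs_of_pos (exp_pos _)] using hL0 θ)
  set q := μ.tilted fun θ => -L θ with hq
  have : IsProbabilityMeasure q := isProbabilityMeasure_tilted hexpL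
  have hz : 0 < ∫ θ, exp (-L θ) ∂μ := integral_exp_pos hexpL
  have hM : 0 < ∫ θ, exp (g θ) ∂μ := integral_exp_pos hexp
  set z := ∫ θ, exp (-L θ) ∂μ
  set M := ∫ θ, exp (g θ) ∂μ
  -- the Radon-Nikodym weight `exp (L + g) * z` turns `q` into `exp g • μ`
  have hweight : ∀ θ, (exp (-L θ) / z) * (exp (L θ + g θ) * z) = exp (g θ) := fun θ => by
    have : exp (-L θ) * exp (L θ + g θ) = exp (g θ) := by rw [← exp_add]; congr 1; ring
    field_simp
    linarith
  have hW : Integrable (fun θ => exp (L θ + g θ) * z) q := by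
    refine Integrable.mul_const ?_ z
    rw [hq, integrable_tilted_iff hexpL]
    refine hexp.congr (ae_of_all _ fun θ => ?_)
    simp [← exp_add]
  have hWint : ∫ θ, exp (L θ + g θ) * z ∂q = M := by
    rw [hq, integral_tilted]
    exact integral_congr_ae (ae_of_all _ fun θ => hweight θ)
  have hpt : ∀ θ, L θ + g θ ≤ (exp (L θ + g θ) * z) / M - 1 + log M - log z := fun θ => by
    have := log_le_sub_one_of_pos (x := exp (L θ + g θ) * z / M) (by positivity)
    rw [log_div (by positivity) hM.ne', log_mul (exp_pos _).ne' hz.ne', log_exp] at this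
    linarith
  have hdom : Integrable (fun θ => (exp (L θ + g θ) * z) / M - 1 + log M - log z) q :=
    (((hW.div_const M).sub (integrable_const 1)).add (integrable_const _)).sub
      (integrable_const _)
  have hLg : Integrable (fun θ => L θ + g θ) q :=
    hdom.mono' (by fun_prop) (ae_of_all _ fun θ => by
      rw [norm_of_nonneg (add_nonneg (hL0 θ) (hg0 θ))]
      exact hpt θ)
  have hLint : Integrable L q :=
    hLg.mono' (by fun_prop) (ae_of_all _ fun θ => by
      rw [norm_of_nonneg (hL0 θ)]
      linarith [hg0 θ])
  have hAint : Integrable A q :=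
    (hLg.const_mul 2).mono' (by fun_prop) (ae_of_all _ fun θ => by
      rw [norm_of_nonneg (hA0 θ)]
      linarith [hg0 θ, hAL θ])
  have hKL : KLreal q μ = ∫ θ, (-L θ - log z) ∂q :=
    integral_congr_ae ((tilted_absolutelyContinuous μ _).ae_le
      (log_rnDeriv_tilted_left_self hexpL))
  have hKLint : Integrable (fun θ => -L θ - log z) q := hLint.neg.sub (integrable_const _)
  calc ∫ θ, A θ ∂q + KLreal q μ = ∫ θ, (A θ + (-L θ - log z)) ∂q := by
        rw [hKL, integral_add hAint hKLint]
    _ ≤ ∫ θ, ((exp (L θ + g θ) * z) / M + (-1 + log M - 2 * log z)) ∂q := by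
        refine integral_mono (hAint.add hKLint) ((hW.div_const M).add (integrable_const _))
          fun θ => ?_
        have h1 := hpt θ
        have h2 := hAL θ
        simp only
        linarith
    _ = 2 * log (1 / z) + log M := by
        rw [integral_add (hW.div_const M) (integrable_const _), integral_div, hWint,
          div_self hM.ne', integral_const, one_div, log_inv]
        simp
        ring

/-- Bound on the Gibbs objective of the Bayes posterior evaluated with the adversarial
loss: with prior `π = N(0, σ_p² I_d)`, standard loss `L`, adversarial loss `L_δ̂`,
normalizer `z = ∫ exp(−L) dπ` and posterior `q` of density `exp(−L)/z` w.r.t. `π`,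
`E_{θ∼q}[(1/n)L_δ̂(θ)] + (1/n)KL(q‖π) ≤ (2/n)log(1/z)
  + dδ̂²σ_p²/(σ² − 2nδ̂²σ_p²)`. -/
theorem bayes_posterior_adversarial_gibbs_objective_bound
    (n d : ℕ) (hn : 0 < n) (σ σp δh : ℝ)
    (hσ : 0 < σ) (hσp : 0 < σp) (hδh : 0 ≤ δh)
    (hcond : 2 * (n : ℝ) * δh ^ 2 * σp ^ 2 < σ ^ 2)
    (X : Matrix (Fin n) (Fin d) ℝ) (Y : Fin n → ℝ)
    (pr : Measure (Fin d → ℝ))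
    (hpr : pr = Measure.pi fun _ : Fin d => gaussianReal 0 ⟨σp ^ 2, sq_nonneg σp⟩)
    (L : (Fin d → ℝ) → ℝ)
    (hL : L = fun θ => (1 / (2 * σ ^ 2)) * ∑ i, (Y i - X.mulVec θ i) ^ 2)
    (Lδh : (Fin d → ℝ) → ℝ)
    (hLδh : Lδh = fun θ => ∑ i, (1 / (2 * σ ^ 2))
      * (|Y i - X.mulVec θ i| + δh * Real.sqrt (∑ j, θ j ^ 2)) ^ 2)
    (z : ℝ) (hz : z = ∫ θ, Real.exp (-L θ) ∂pr)
    (q : Measure (Fin d → ℝ))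
    (hq : q = pr.withDensity fun θ => ENNReal.ofReal (Real.exp (-L θ) / z)) :
    (∫ θ, (1 / (n : ℝ)) * Lδh θ ∂q) + (1 / (n : ℝ)) * KLreal q pr
      ≤ (2 / (n : ℝ)) * Real.log (1 / z)
        + (d : ℝ) * δh ^ 2 * σp ^ 2 / (σ ^ 2 - 2 * (n : ℝ) * δh ^ 2 * σp ^ 2) := by
  subst hLδh hz hq
  have hσ2 : 0 < σ ^ 2 := by positivity
  have hn0 : (0 : ℝ) < n := by exact_mod_cast hn
  set v : NNReal := ⟨σp ^ 2, sq_nonneg σp⟩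
  have hvσ : (v : ℝ) = σp ^ 2 := rfl
  have hv : v ≠ 0 := by
    rw [← NNReal.coe_ne_zero, hvσ]
    positivity
  set t : ℝ := n * δh ^ 2 / σ ^ 2 with htdef
  have htv : 2 * t * v = 2 * n * δh ^ 2 * σp ^ 2 / σ ^ 2 := by
    rw [hvσ, htdef]
    ring
  have ht : 2 * t * v < 1 := by rwa [htv, div_lt_one hσ2]
  obtain ⟨hexp, hM⟩ := integrable_exp_mul_sum_sq_pi_gaussianReal (ι := Fin d) hv ht
  rw [← hpr] at hexp hM
  have : IsProbabilityMeasure pr := by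
    rw [hpr]
    infer_instance
  have hmulVec : ∀ i, Measurable fun θ : Fin d → ℝ => X.mulVec θ i := fun i => by
    unfold Matrix.mulVec dotProduct
    fun_prop
  have hLmeas : Measurable L := by
    rw [hL]
    fun_prop
  have hbound := integral_add_KLreal_tilted_le pr (L := L)
    (A := fun θ => ∑ i, (1 / (2 * σ ^ 2))
      * (|Y i - X.mulVec θ i| + δh * Real.sqrt (∑ j, θ j ^ 2)) ^ 2)
    (g := fun θ => t * ∑ j, θ j ^ 2) hLmeas
    (by
      have habs : ∀ i, Measurable fun θ : Fin d → ℝ => |Y i - X.mulVec θ i| :=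
        fun i => ((hmulVec i).const_sub (Y i)).abs
      fun_prop)
    (by fun_prop)
    (fun θ => by rw [hL]; positivity) (fun θ => by positivity) (fun θ => by positivity)
    (fun θ => by
      have hterm : ∀ i ∈ Finset.univ, (1 / (2 * σ ^ 2))
          * (|Y i - X.mulVec θ i| + δh * Real.sqrt (∑ j, θ j ^ 2)) ^ 2 ≤
          (1 / (2 * σ ^ 2)) * (2 * (Y i - X.mulVec θ i) ^ 2 +
            2 * (δh ^ 2 * ∑ j, θ j ^ 2)) := fun i _ => by
        refine mul_le_mul_of_nonneg_left ?_ (by positivity)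
        have h := add_sq_le (a := |Y i - X.mulVec θ i|) (b := δh * Real.sqrt (∑ j, θ j ^ 2))
        rw [sq_abs, mul_pow, Real.sq_sqrt (by positivity)] at h
        linarith
      refine (Finset.sum_le_sum hterm).trans_eq ?_
      rw [← Finset.mul_sum, Finset.sum_add_distrib, ← Finset.mul_sum, hL, htdef]
      simp only [Finset.sum_const, Finset.card_univ, Fintype.card_fin, nsmul_eq_mul]
      field_simp)
    hexp
  have hlog : Real.log (∫ θ, Real.exp (t * ∑ j, θ j ^ 2) ∂pr) ≤
      n * (d * δh ^ 2 * σp ^ 2 / (σ ^ 2 - 2 * n * δh ^ 2 * σp ^ 2)) := by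
    rw [hM, Fintype.card_fin, Real.log_pow]
    refine (mul_le_mul_of_nonneg_left (log_inv_sqrt_one_sub_le ht) (by positivity)).trans_eq ?_
    have hne : σ ^ 2 - 2 * n * δh ^ 2 * σp ^ 2 ≠ 0 := (sub_pos.2 hcond).ne'
    have hsub : 1 - 2 * t * v = (σ ^ 2 - 2 * n * δh ^ 2 * σp ^ 2) / σ ^ 2 := by
      rw [htv]
      field_simp
    rw [hsub, htv]
    field_simp
  rw [integral_const_mul, ← mul_add]
  have hfin := mul_le_mul_of_nonneg_left (hbound.trans (add_le_add_right hlog _))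
    (one_div_nonneg.2 hn0.le)
  refine hfin.trans_eq ?_
  field_simp
end
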